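/- For every w ∈ A0_xy and every w' ∈ A+_xy: (q−1)·[i]·(F0·F+)_{w,x} = q^{i+1}·[n−k−i]·((F0)²)_{w',x}, and (q−1)·[i]·((F+)²)_{w,x} = q^{i+1}·[n−k−i]·(F0·F+)_{w',x}. -/

import Mathlib

open scoped Classical

noncomputable section

variable {F V : Type} [Field F] [AddCommGroup V] [Module F V]

/-- `v` covers `u` in the projective geometry `P`. -/
def Covers (u v : Submodule F V) : Prop :=
  u ≤ v ∧ Module.finrank F ↥v = Module.finrank F ↥u + 1

/-- `v` slash-covers `u` (relative to the fixed subspace `y`). -/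
def SlashCovers (y u v : Submodule F V) : Prop :=
  Covers u v ∧ Module.finrank F ↥(v ⊓ y) = Module.finrank F ↥(u ⊓ y) + 1

/-- `v` backslash-covers `u` (relative to the fixed subspace `y`). -/
def BackslashCovers (y u v : Submodule F V) : Prop :=
  Covers u v ∧ Module.finrank F ↥(v ⊓ y) = Module.finrank F ↥(u ⊓ y)

/-- `q` raised to a real exponent, as a complex number. -/
def qpow (q : ℕ) (e : ℝ) : ℂ := (((q : ℝ) ^ e : ℝ) : ℂ)

/-- The Gaussian bracket `[m] = (q^m - 1)/(q - 1)` as a rational number. -/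
def gaussQ (q m : ℕ) : ℚ := ((q : ℚ) ^ m - 1) / ((q : ℚ) - 1)

/-- The Gaussian bracket `[m] = (q^m - 1)/(q - 1)` as a complex number. -/
def gaussC (q m : ℕ) : ℂ := ((q : ℂ) ^ m - 1) / ((q : ℂ) - 1)

/-- The diagonal matrix `K1`; the `(u,u)` entry is `q^(k/2 - i)` for `u ∈ P_{i,j}`. -/
def matK1 (q k : ℕ) (y : Submodule F V) : Matrix (Submodule F V) (Submodule F V) ℂ :=
  Matrix.diagonal fun u => qpow q ((k : ℝ) / 2 - (Module.finrank F ↥(u ⊓ y) : ℝ))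

/-- The diagonal matrix `K2`; the `(u,u)` entry is `q^(j - (n-k)/2)` for `u ∈ P_{i,j}`. -/
def matK2 (q n k : ℕ) (y : Submodule F V) : Matrix (Submodule F V) (Submodule F V) ℂ :=
  Matrix.diagonal fun u =>
    qpow q (((Module.finrank F ↥u : ℝ) - (Module.finrank F ↥(u ⊓ y) : ℝ))
      - ((n : ℝ) - (k : ℝ)) / 2)

/-- The 0-1 matrix `L1`; the `(u,v)` entry is `1` iff `v` slash-covers `u`. -/
def matL1 (y : Submodule F V) : Matrix (Submodule F V) (Submodule F V) ℂ :=
  Matrix.of fun u v => if SlashCovers y u v then (1 : ℂ) else 0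

/-- The 0-1 matrix `L2`; the `(u,v)` entry is `1` iff `v` backslash-covers `u`. -/
def matL2 (y : Submodule F V) : Matrix (Submodule F V) (Submodule F V) ℂ :=
  Matrix.of fun u v => if BackslashCovers y u v then (1 : ℂ) else 0

/-- `R1 = L1ᵀ`. -/
def matR1 (y : Submodule F V) : Matrix (Submodule F V) (Submodule F V) ℂ := Matrix.transpose (matL1 y)

/-- `R2 = L2ᵀ`. -/
def matR2 (y : Submodule F V) : Matrix (Submodule F V) (Submodule F V) ℂ := Matrix.transpose (matL2 y)

/-- `R = L1 · R2`. -/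
def matR [Fintype (Submodule F V)] (y : Submodule F V) :
    Matrix (Submodule F V) (Submodule F V) ℂ := matL1 y * matR2 y

/-- `L = R1 · L2`. -/
def matL [Fintype (Submodule F V)] (y : Submodule F V) :
    Matrix (Submodule F V) (Submodule F V) ℂ := matR1 y * matL2 y

/-- The 0-1 matrix `F0`. -/
def matF0 (y : Submodule F V) : Matrix (Submodule F V) (Submodule F V) ℂ :=
  Matrix.of fun u v =>
    if SlashCovers y u (u ⊔ v) ∧ SlashCovers y v (u ⊔ v) ∧
        BackslashCovers y (u ⊓ v) u ∧ BackslashCovers y (u ⊓ v) v then (1 : ℂ) else 0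

/-- The 0-1 matrix `F+`. -/
def matFp (y : Submodule F V) : Matrix (Submodule F V) (Submodule F V) ℂ :=
  Matrix.of fun u v =>
    if BackslashCovers y u (u ⊔ v) ∧ BackslashCovers y v (u ⊔ v) then (1 : ℂ) else 0

/-- The 0-1 matrix `F-`. -/
def matFm (y : Submodule F V) : Matrix (Submodule F V) (Submodule F V) ℂ :=
  Matrix.of fun u v =>
    if SlashCovers y (u ⊓ v) u ∧ SlashCovers y (u ⊓ v) v then (1 : ℂ) else 0

/-- The vertex set `X` of the Grassmann graph: `k`-dimensional subspaces of `V`. -/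
abbrev GrassVertex (F V : Type) [Field F] [AddCommGroup V] [Module F V] (k : ℕ) :=
  {z : Submodule F V // Module.finrank F ↥z = k}

/-- The Grassmann graph `J_q(n,k)`: vertices are adjacent iff their intersection
has dimension `k - 1`. -/
def Grass (F V : Type) [Field F] [AddCommGroup V] [Module F V] (k : ℕ) :
    SimpleGraph (GrassVertex F V k) :=
  SimpleGraph.fromRel fun a b => Module.finrank F ↥(a.1 ⊓ b.1) = k - 1

/-- `B_xy = {z ∈ Γ(x) : ∂(z,y) = ∂(x,y) + 1}`. -/
def Bset {k : ℕ} (x y : GrassVertex F V k) : Set (GrassVertex F V k) :=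
  {z | (Grass F V k).Adj x z ∧ (Grass F V k).dist z y = (Grass F V k).dist x y + 1}

/-- `C_xy = {z ∈ Γ(x) : ∂(z,y) = ∂(x,y) - 1}`. -/
def Cset {k : ℕ} (x y : GrassVertex F V k) : Set (GrassVertex F V k) :=
  {z | (Grass F V k).Adj x z ∧ (Grass F V k).dist z y = (Grass F V k).dist x y - 1}

/-- `A_xy = {z ∈ Γ(x) : ∂(z,y) = ∂(x,y)}`. -/
def Aset {k : ℕ} (x y : GrassVertex F V k) : Set (GrassVertex F V k) :=
  {z | (Grass F V k).Adj x z ∧ (Grass F V k).dist z y = (Grass F V k).dist x y}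

/-- `A0_xy`. -/
def A0set {k : ℕ} (x y : GrassVertex F V k) : Set (GrassVertex F V k) :=
  {z | (Grass F V k).Adj x z ∧
    SlashCovers y.1 z.1 (z.1 ⊔ x.1) ∧ SlashCovers y.1 x.1 (z.1 ⊔ x.1) ∧
    BackslashCovers y.1 (z.1 ⊓ x.1) z.1 ∧ BackslashCovers y.1 (z.1 ⊓ x.1) x.1}

/-- `A+_xy`. -/
def Apset {k : ℕ} (x y : GrassVertex F V k) : Set (GrassVertex F V k) :=
  {z | (Grass F V k).Adj x z ∧
    BackslashCovers y.1 z.1 (z.1 ⊔ x.1) ∧ BackslashCovers y.1 x.1 (z.1 ⊔ x.1)}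

/-- `A-_xy`. -/
def Amset {k : ℕ} (x y : GrassVertex F V k) : Set (GrassVertex F V k) :=
  {z | (Grass F V k).Adj x z ∧
    SlashCovers y.1 (z.1 ⊓ x.1) z.1 ∧ SlashCovers y.1 (z.1 ⊓ x.1) x.1}

/-- The edge `wz` has type `0`. -/
def EdgeType0 {k : ℕ} (y w z : GrassVertex F V k) : Prop :=
  SlashCovers y.1 w.1 (w.1 ⊔ z.1) ∧ SlashCovers y.1 z.1 (w.1 ⊔ z.1) ∧
  BackslashCovers y.1 (w.1 ⊓ z.1) w.1 ∧ BackslashCovers y.1 (w.1 ⊓ z.1) z.1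

/-- The edge `wz` has type `+`. -/
def EdgeTypeP {k : ℕ} (y w z : GrassVertex F V k) : Prop :=
  BackslashCovers y.1 w.1 (w.1 ⊔ z.1) ∧ BackslashCovers y.1 z.1 (w.1 ⊔ z.1)

/-- The edge `wz` has type `-`. -/
def EdgeTypeM {k : ℕ} (y w z : GrassVertex F V k) : Prop :=
  SlashCovers y.1 (w.1 ⊓ z.1) w.1 ∧ SlashCovers y.1 (w.1 ⊓ z.1) z.1

section Lattice

open Module

lemma not_le_of_finrank_sup {u v : Submodule F V}
    (h : finrank F ↥(u ⊔ v) = finrank F u + 1) : ¬ v ≤ u := fun hle => by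
  rw [sup_eq_left.2 hle] at h
  omega

/-- The subspaces that cover `h`, lie in `t`, and do not lie in `b`. -/
def coversNotLe [Fintype (Submodule F V)] (h b t : Submodule F V) : Finset (Submodule F V) :=
  Finset.univ.filter fun z => h ≤ z ∧ finrank F z = finrank F h + 1 ∧ z ≤ t ∧ ¬ z ≤ b

lemma mem_coversNotLe [Fintype (Submodule F V)] {h b t z : Submodule F V} :
    z ∈ coversNotLe h b t ↔ h ≤ z ∧ finrank F z = finrank F h + 1 ∧ z ≤ t ∧ ¬ z ≤ b := by
  simp [coversNotLe]

variable [FiniteDimensional F V]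

lemma eq_of_covers_of_le {h z w : Submodule F V} (hw : h ≤ w)
    (dz : finrank F z = finrank F h + 1) (hwz : w ≤ z) (hne : ¬ z ≤ w) : w = h := by
  have := Submodule.finrank_lt_finrank_of_lt (lt_of_le_not_ge hwz hne)
  exact (Submodule.eq_of_le_of_finrank_le hw (by omega)).symm

lemma inf_eq_of_covers {h z b : Submodule F V} (hz : h ≤ z)
    (dz : finrank F z = finrank F h + 1) (hb : h ≤ b) (hzb : ¬ z ≤ b) : z ⊓ b = h :=
  eq_of_covers_of_le (le_inf hz hb) dz inf_le_left fun H => hzb (H.trans inf_le_right)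

/-- Subspaces of the same dimension and the same trace on `y`, adjacent in the Grassmann graph. -/
def TraceAdj (y u v : Submodule F V) : Prop :=
  finrank F v = finrank F u ∧ u ⊓ y = v ⊓ y ∧ finrank F ↥(u ⊔ v) = finrank F u + 1

lemma TraceAdj.finrank_inf {y u v : Submodule F V} (h : TraceAdj y u v) :
    finrank F ↥(u ⊓ v) + 1 = finrank F u := by
  obtain ⟨h1, -, h3⟩ := h
  have := Submodule.finrank_sup_add_finrank_inf_eq u v
  omega

lemma TraceAdj.finrank_sup_right {y u v : Submodule F V} (h : TraceAdj y u v) :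
    finrank F ↥(u ⊔ y) = finrank F ↥(v ⊔ y) := by
  obtain ⟨h1, h2, -⟩ := h
  have e1 := Submodule.finrank_sup_add_finrank_inf_eq u y
  have e2 := Submodule.finrank_sup_add_finrank_inf_eq v y
  rw [h2] at e1
  omega

lemma TraceAdj.sup_eq_of_le {y u v : Submodule F V} (h : TraceAdj y u v) (hle : u ≤ v ⊔ y) :
    u ⊔ y = v ⊔ y :=
  Submodule.eq_of_le_of_finrank_eq (sup_le hle le_sup_right) h.finrank_sup_right

/-- The trace on `y` grows in the join of adjacent subspaces iff their joins with `y` agree. -/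
lemma TraceAdj.finrank_sup_inf {y u v : Submodule F V} (h : TraceAdj y u v) :
    finrank F ↥((u ⊔ v) ⊓ y) = finrank F ↥(u ⊓ y) + if u ⊔ y = v ⊔ y then 1 else 0 := by
  have e1 := Submodule.finrank_sup_add_finrank_inf_eq u y
  have e2 := Submodule.finrank_sup_add_finrank_inf_eq (u ⊔ v) y
  have e3 : (u ⊔ v) ⊔ y = (v ⊔ y) ⊔ (u ⊔ y) := by
    rw [sup_sup_sup_comm, sup_idem, sup_comm v u]
  have e4 := h.2.2
  split_ifs with huv
  · rw [e3, ← huv, sup_idem] at e2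
    omega
  · have hlt : u ⊔ y < (u ⊔ v) ⊔ y := by
      refine lt_of_le_of_ne (sup_le_sup_right le_sup_left _) fun H => huv ?_
      refine (Submodule.eq_of_le_of_finrank_eq ?_ h.finrank_sup_right.symm).symm
      rw [H, e3]
      exact le_sup_left
    have h5 := Submodule.finrank_lt_finrank_of_lt hlt
    have h6 : finrank F ↥(u ⊓ y) ≤ finrank F ↥((u ⊔ v) ⊓ y) :=
      Submodule.finrank_mono (inf_le_inf_right _ le_sup_left)
    omega

lemma matF0_apply (y u v : Submodule F V) :
    matF0 y u v = if TraceAdj y u v ∧ u ⊔ y = v ⊔ y then 1 else 0 := by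
  unfold matF0
  rw [Matrix.of_apply]
  congr 1
  refine propext ⟨?_, ?_⟩
  · rintro ⟨⟨⟨-, h1⟩, h2⟩, ⟨⟨-, h3⟩, h4⟩, ⟨-, h5⟩, ⟨-, h6⟩⟩
    have e5 := Submodule.eq_of_le_of_finrank_eq (inf_le_inf_right y inf_le_left) h5.symm
    have e6 := Submodule.eq_of_le_of_finrank_eq (inf_le_inf_right y inf_le_right) h6.symm
    have hA : TraceAdj y u v := ⟨by omega, e5.symm.trans e6, h1⟩
    refine ⟨hA, ?_⟩
    have := hA.finrank_sup_inf
    by_contra H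
    rw [if_neg H] at this
    omega
  · rintro ⟨hA, huv⟩
    have h1 := hA.finrank_sup_inf
    rw [if_pos huv] at h1
    have h2 := hA.finrank_inf
    obtain ⟨h3, h4, h5⟩ := hA
    have h6 : u ⊓ v ⊓ y = u ⊓ y := by
      rw [inf_inf_distrib_right, ← h4, inf_idem]
    refine ⟨⟨⟨le_sup_left, h5⟩, h1⟩, ⟨⟨le_sup_right, by omega⟩, by rw [h1, h4]⟩,
      ⟨⟨inf_le_left, h2.symm⟩, by rw [h6]⟩, ⟨⟨inf_le_right, by omega⟩, by rw [h6, h4]⟩⟩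

lemma matFp_apply (y u v : Submodule F V) :
    matFp y u v = if TraceAdj y u v ∧ u ⊔ y ≠ v ⊔ y then 1 else 0 := by
  unfold matFp
  rw [Matrix.of_apply]
  congr 1
  refine propext ⟨?_, ?_⟩
  · rintro ⟨⟨⟨-, h1⟩, h2⟩, ⟨⟨-, h3⟩, h4⟩⟩
    have e5 := Submodule.eq_of_le_of_finrank_eq
      (inf_le_inf_right y (le_sup_left : u ≤ u ⊔ v)) h2.symm
    have e6 := Submodule.eq_of_le_of_finrank_eq
      (inf_le_inf_right y (le_sup_right : v ≤ u ⊔ v)) h4.symm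
    have hA : TraceAdj y u v := ⟨by omega, e5.trans e6.symm, h1⟩
    refine ⟨hA, fun H => ?_⟩
    have := hA.finrank_sup_inf
    rw [if_pos H] at this
    omega
  · rintro ⟨hA, huv⟩
    have h1 := hA.finrank_sup_inf
    rw [if_neg huv] at h1
    obtain ⟨h3, h4, h5⟩ := hA
    exact ⟨⟨⟨le_sup_left, h5⟩, h1⟩, ⟨⟨le_sup_right, by omega⟩, by rw [h1, h4, add_zero]⟩⟩

lemma traceAdj_of_inf_eq {y h u v : Submodule F V} (du : finrank F u = finrank F h + 1)
    (dv : finrank F v = finrank F h + 1) (huv : u ⊓ v = h) (hy : u ⊓ y = v ⊓ y) :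
    TraceAdj y u v := by
  refine ⟨by omega, hy, ?_⟩
  have := Submodule.finrank_sup_add_finrank_inf_eq u v
  rw [huv] at this
  omega

lemma matF0_matFp_path_iff {y w x z : Submodule F V}
    (hwx : TraceAdj y w x ∧ w ⊔ y ≠ x ⊔ y) :
    ((TraceAdj y w z ∧ w ⊔ y = z ⊔ y) ∧ (TraceAdj y z x ∧ z ⊔ y ≠ x ⊔ y)) ↔
      (w ⊓ x ≤ z ∧ finrank F z = finrank F ↥(w ⊓ x) + 1 ∧ z ≤ w ⊔ y ∧
        ¬ z ≤ (w ⊓ x) ⊔ y) ∧ z ≠ w := by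
  obtain ⟨hA, hne⟩ := hwx
  have dw := hA.finrank_inf
  have hxw : ¬ x ≤ w ⊔ y := fun H => hne (Submodule.eq_of_le_of_finrank_eq
    (sup_le H le_sup_right) hA.finrank_sup_right.symm).symm
  have dx := hA.1
  have hxh : x ⊓ (w ⊔ y) = w ⊓ x :=
    inf_eq_of_covers inf_le_right (by omega) (inf_le_left.trans le_sup_left) hxw
  have ha : w ⊓ y ≤ w ⊓ x := le_inf inf_le_left (hA.2.1.le.trans inf_le_left)
  constructor
  · rintro ⟨⟨hwz, e⟩, ⟨hzx, e'⟩⟩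
    have hz : z ≤ w ⊔ y := le_sup_left.trans e.ge
    have d1 := hzx.finrank_inf
    have d2 := hwz.1
    have hle : z ⊓ x ≤ w ⊓ x := by
      rw [← hxh, inf_comm]
      exact inf_le_inf_left _ hz
    have heq := Submodule.eq_of_le_of_finrank_eq hle (by omega)
    have hhz : w ⊓ x ≤ z := heq.ge.trans inf_le_left
    refine ⟨⟨hhz, by omega, hz, fun H => ?_⟩, fun H => ?_⟩
    · have h1 : z ≤ (w ⊓ x) ⊔ y ⊓ z := by
        rw [← sup_inf_assoc_of_le _ hhz]
        exact le_inf H le_rfl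
      have h2 : z ≤ w ⊓ x := h1.trans (sup_le le_rfl (by rw [inf_comm, ← hwz.2.1]; exact ha))
      have := Submodule.finrank_mono h2
      omega
    · exact not_le_of_finrank_sup hwz.2.2 H.le
  · rintro ⟨⟨hhz, dz, hz, hzy⟩, hzw⟩
    have hzy' : z ⊓ y = w ⊓ y := by
      apply le_antisymm
      · have := inf_eq_of_covers hhz dz le_sup_left hzy
        exact le_inf ((inf_le_inf_left z le_sup_right).trans
          (this.le.trans inf_le_left)) inf_le_right
      · exact le_inf (ha.trans hhz) inf_le_right
    have hzx : z ⊓ x = w ⊓ x := by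
      apply le_antisymm
      · rw [← hxh, inf_comm]
        exact inf_le_inf_left _ hz
      · exact le_inf hhz inf_le_right
    have hwz : w ⊓ z = w ⊓ x := by
      rw [inf_comm]
      refine inf_eq_of_covers hhz dz inf_le_left fun H => hzw ?_
      exact Submodule.eq_of_le_of_finrank_eq H (by omega)
    have t1 : TraceAdj y w z := traceAdj_of_inf_eq (by omega) dz hwz hzy'.symm
    have t2 : TraceAdj y z x := traceAdj_of_inf_eq dz (by omega) hzx (hzy'.trans hA.2.1)
    have e : w ⊔ y = z ⊔ y := (Submodule.eq_of_le_of_finrank_eq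
      (sup_le hz le_sup_right) t1.finrank_sup_right.symm).symm
    exact ⟨⟨t1, e⟩, t2, e ▸ hne⟩

lemma matFp_matFp_path_iff {y w x z : Submodule F V}
    (hwx : TraceAdj y w x ∧ w ⊔ y = x ⊔ y) :
    ((TraceAdj y w z ∧ w ⊔ y ≠ z ⊔ y) ∧ (TraceAdj y z x ∧ z ⊔ y ≠ x ⊔ y)) ↔
      (w ⊓ x ≤ z ∧ finrank F z = finrank F ↥(w ⊓ x) + 1 ∧ z ≤ ⊤ ∧ ¬ z ≤ x ⊔ y) := by
  obtain ⟨hA, hex⟩ := hwx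
  have dw := hA.finrank_inf
  have dx := hA.1
  have ha : w ⊓ y ≤ w ⊓ x := le_inf inf_le_left (hA.2.1.le.trans inf_le_left)
  have hw : w ≤ x ⊔ y := le_sup_left.trans hex.le
  constructor
  · rintro ⟨⟨hwz, e⟩, ⟨hzx, e'⟩⟩
    have hz : ¬ z ≤ x ⊔ y := fun H => e' (hzx.sup_eq_of_le H)
    have d1 := hzx.finrank_inf
    have d2 := hwz.1
    have d3 := hwz.finrank_inf
    have i1 : z ⊓ (x ⊔ y) = z ⊓ x := inf_eq_of_covers inf_le_left (by omega)
      (inf_le_right.trans le_sup_left) hz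
    have hle : w ⊓ z ≤ w ⊓ x :=
      le_inf inf_le_left ((le_inf inf_le_right (inf_le_left.trans hw)).trans
        (i1.le.trans inf_le_right))
    have heq := Submodule.eq_of_le_of_finrank_eq hle (by omega)
    exact ⟨heq.ge.trans inf_le_right, by omega, le_top, hz⟩
  · rintro ⟨hhz, dz, -, hz⟩
    have i1 : z ⊓ (x ⊔ y) = w ⊓ x :=
      inf_eq_of_covers hhz dz (inf_le_right.trans le_sup_left) hz
    have hzy' : z ⊓ y = w ⊓ y := by
      apply le_antisymm
      · exact le_inf ((inf_le_inf_left z le_sup_right).trans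
          (i1.le.trans inf_le_left)) inf_le_right
      · exact le_inf (ha.trans hhz) inf_le_right
    have hzx : z ⊓ x = w ⊓ x :=
      le_antisymm ((inf_le_inf_left z le_sup_left).trans i1.le) (le_inf hhz inf_le_right)
    have hwz : w ⊓ z = w ⊓ x := by
      rw [inf_comm]
      exact le_antisymm ((inf_le_inf_left z hw).trans i1.le) (le_inf hhz inf_le_left)
    have t1 : TraceAdj y w z := traceAdj_of_inf_eq (by omega) dz hwz hzy'.symm
    have t2 : TraceAdj y z x := traceAdj_of_inf_eq dz (by omega) hzx (hzy'.trans hA.2.1)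
    have e : z ⊔ y ≠ x ⊔ y := fun H => hz (le_sup_left.trans H.le)
    exact ⟨⟨t1, fun H => e (H.symm.trans hex)⟩, t2, e⟩

lemma card_coversNotLe_mul [Fintype F] [Fintype (Submodule F V)] {h b t : Submodule F V}
    (hhb : h ≤ b) (hbt : b ≤ t) :
    (coversNotLe h b t).card *
      (Fintype.card F ^ (finrank F h + 1) - Fintype.card F ^ finrank F h) =
    Fintype.card F ^ finrank F t - Fintype.card F ^ finrank F b := by
  have : Finite V := Module.finite_of_finite F
  have : Fintype V := Fintype.ofFinite V
  have hcard (u v : Submodule F V) (huv : u ≤ v) :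
      (Finset.univ.filter fun a : V => a ∈ v ∧ a ∉ u).card =
        Fintype.card F ^ finrank F v - Fintype.card F ^ finrank F u := by
    rw [← Module.card_eq_pow_finrank (K := F) (V := v),
      ← Module.card_eq_pow_finrank (K := F) (V := u), Fintype.card_subtype, Fintype.card_subtype,
      Finset.filter_and_not, Finset.card_sdiff_of_subset]
    intro a
    simpa using fun ha => huv ha
  rw [← hcard b t hbt, Finset.card_eq_sum_card_fiberwise (f := fun a : V => h ⊔ F ∙ a)
    (t := coversNotLe h b t)]
  · rw [Finset.sum_const_nat]
    intro z hz
    obtain ⟨hz1, hz2, hz3, hz4⟩ := mem_coversNotLe.1 hz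
    rw [← hz2, ← hcard h z hz1]
    congr 1
    ext a
    simp only [Finset.mem_filter, Finset.mem_univ, true_and]
    have hzb := inf_eq_of_covers hz1 hz2 hhb hz4
    constructor
    · rintro ⟨⟨-, ha⟩, rfl⟩
      exact ⟨Submodule.mem_sup_right (Submodule.mem_span_singleton_self a), fun H => ha (hhb H)⟩
    · rintro ⟨ha, hah⟩
      refine ⟨⟨hz3 ha, fun H => hah (hzb.le ⟨ha, H⟩)⟩, ?_⟩
      refine Submodule.eq_of_le_of_finrank_eq
        (sup_le hz1 ((Submodule.span_singleton_le_iff_mem _ _).2 ha)) ?_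
      rw [Submodule.finrank_sup_span_singleton hah, hz2]
  · intro a ha
    simp only [Finset.coe_filter, Finset.mem_univ, true_and, Set.mem_ofPred_eq] at ha
    refine mem_coversNotLe.2 ⟨le_sup_left, Submodule.finrank_sup_span_singleton fun H => ha.2 (hhb H),
      sup_le (hhb.trans hbt) ((Submodule.span_singleton_le_iff_mem _ _).2 ha.1), fun H => ha.2 ?_⟩
    exact H (Submodule.mem_sup_right (Submodule.mem_span_singleton_self a))

lemma finrank_inf_le_of_adj {k : ℕ} (hk : 1 ≤ k) {x z : GrassVertex F V k}
    (h : (Grass F V k).Adj x z) (y : Submodule F V) :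
    finrank F ↥(z.1 ⊓ y) ≤ finrank F ↥(x.1 ⊓ y) + 1 := by
  have hd : finrank F ↥(x.1 ⊓ z.1) = k - 1 := by
    rcases (SimpleGraph.fromRel_adj _ _ _).1 h with ⟨-, h | h⟩
    · exact h
    · rwa [inf_comm]
  have e1 := Submodule.finrank_sup_add_finrank_inf_eq x.1 z.1
  have e2 := Submodule.finrank_sup_add_finrank_inf_eq x.1 (z.1 ⊓ y)
  have h1 : finrank F ↥(x.1 ⊔ z.1 ⊓ y) ≤ finrank F ↥(x.1 ⊔ z.1) :=
    Submodule.finrank_mono (sup_le_sup_left inf_le_left _)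
  have h2 : finrank F ↥(x.1 ⊓ (z.1 ⊓ y)) ≤ finrank F ↥(x.1 ⊓ y) :=
    Submodule.finrank_mono (inf_le_inf_left _ inf_le_right)
  have := x.2
  have := z.2
  omega

lemma le_finrank_inf_add_length {k : ℕ} (hk : 1 ≤ k) {x y : GrassVertex F V k}
    (p : (Grass F V k).Walk x y) : k ≤ finrank F ↥(x.1 ⊓ y.1) + p.length := by
  induction p with
  | @nil u =>
    rw [inf_idem, u.2]
    exact Nat.le_add_right _ _
  | @cons _ _ y h p ih =>
    have := finrank_inf_le_of_adj hk h y.1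
    rw [SimpleGraph.Walk.length_cons]
    omega

lemma exists_hyperplane_ge {u v : Submodule F V} (h : u < v) :
    ∃ w, u ≤ w ∧ w ≤ v ∧ finrank F v = finrank F w + 1 := by
  obtain ⟨w, huw, hwv⟩ := exists_le_covBy_of_lt h
  refine ⟨w, huw, hwv.le, ?_⟩
  obtain ⟨a, ha, haw⟩ := SetLike.exists_of_lt hwv.lt
  have hlt : w < w ⊔ F ∙ a := by
    refine lt_of_le_not_ge le_sup_left fun H => haw (H ?_)
    exact Submodule.mem_sup_right (Submodule.mem_span_singleton_self a)
  have hle : w ⊔ F ∙ a ≤ v := sup_le hwv.le ((Submodule.span_singleton_le_iff_mem _ _).2 ha)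
  rw [← (hwv.wcovBy.eq_or_eq hlt.le hle).resolve_left hlt.ne',
    Submodule.finrank_sup_span_singleton haw]

lemma exists_walk_length_le {k : ℕ} (y : GrassVertex F V k) (d : ℕ) :
    ∀ x : GrassVertex F V k, k ≤ finrank F ↥(x.1 ⊓ y.1) + d →
      ∃ p : (Grass F V k).Walk x y, p.length ≤ d := by
  induction d with
  | zero =>
    intro x hx
    have h1 := Submodule.eq_of_le_of_finrank_le (inf_le_left : x.1 ⊓ y.1 ≤ x.1)
      (by rw [x.2]; exact hx)
    have h2 := Submodule.eq_of_le_of_finrank_le (inf_le_right : x.1 ⊓ y.1 ≤ y.1)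
      (by rw [y.2]; exact hx)
    obtain rfl : x = y := Subtype.ext (h1.symm.trans h2)
    exact ⟨.nil, le_rfl⟩
  | succ d ih =>
    intro x hx
    by_cases hxy : y.1 ≤ x.1
    · obtain rfl : y = x := Subtype.ext
        (Submodule.eq_of_le_of_finrank_eq hxy (y.2.trans x.2.symm))
      exact ⟨.nil, Nat.zero_le _⟩
    obtain ⟨a, hay, hax⟩ := SetLike.not_le_iff_exists.1 hxy
    have hlt : x.1 ⊓ y.1 < x.1 := lt_of_le_of_ne inf_le_left fun H => hxy <| by
      exact (Submodule.eq_of_le_of_finrank_eq (inf_eq_left.1 H) (x.2.trans y.2.symm)).ge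
    obtain ⟨h, h1, h2, h3⟩ := exists_hyperplane_ge hlt
    have hah : a ∉ h := fun H => hax (h2 H)
    have ha : a ∈ h ⊔ F ∙ a := Submodule.mem_sup_right (Submodule.mem_span_singleton_self a)
    have dz := Submodule.finrank_sup_span_singleton (K := F) hah
    let z : GrassVertex F V k := ⟨h ⊔ F ∙ a, by rw [dz, ← h3, x.2]⟩
    have hxz : x.1 ⊓ z.1 = h := by
      rw [inf_comm]
      exact inf_eq_of_covers le_sup_left dz h2 fun H => hax (H ha)
    have hadj : (Grass F V k).Adj x z := by
      refine (SimpleGraph.fromRel_adj _ _ _).2 ⟨fun H => hax ?_, Or.inl ?_⟩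
      · rw [H]; exact ha
      · rw [hxz, ← x.2, h3, Nat.add_sub_cancel]
    have hlt' : x.1 ⊓ y.1 < z.1 ⊓ y.1 := by
      refine lt_of_le_not_ge (le_inf (h1.trans le_sup_left) inf_le_right) fun H => hax ?_
      exact (H ⟨ha, hay⟩ : a ∈ x.1 ⊓ y.1).1
    have := Submodule.finrank_lt_finrank_of_lt hlt'
    obtain ⟨p, hp⟩ := ih z (by omega)
    exact ⟨.cons hadj p, by rw [SimpleGraph.Walk.length_cons]; omega⟩

/-- The distance in the Grassmann graph is the codimension of the intersection. -/
lemma finrank_inf_add_dist {k : ℕ} (hk : 1 ≤ k) (x y : GrassVertex F V k) :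
    finrank F ↥(x.1 ⊓ y.1) + (Grass F V k).dist x y = k := by
  have hle : finrank F ↥(x.1 ⊓ y.1) ≤ k := (Submodule.finrank_mono inf_le_left).trans x.2.le
  obtain ⟨p, hp⟩ := exists_walk_length_le y (k - finrank F ↥(x.1 ⊓ y.1)) x (by omega)
  have h1 := SimpleGraph.dist_le p
  obtain ⟨r, hr⟩ := SimpleGraph.Reachable.exists_walk_length_eq_dist ⟨p⟩
  have h2 := le_finrank_inf_add_length hk r
  omega

end Lattice

lemma matrix_mul_indicator {α : Type*} [Fintype α] {A B : Matrix α α ℂ} {p r : α → α → Prop}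
    [∀ u v, Decidable (p u v)] [∀ u v, Decidable (r u v)]
    (hA : ∀ u v, A u v = if p u v then 1 else 0) (hB : ∀ u v, B u v = if r u v then 1 else 0)
    (u v : α) [DecidablePred fun z => p u z ∧ r z v] :
    (A * B) u v = ((Finset.univ.filter fun z => p u z ∧ r z v).card : ℂ) := by
  rw [Matrix.mul_apply, ← Finset.sum_boole]
  refine Finset.sum_congr rfl fun z _ => ?_
  rw [hA, hB]
  by_cases hp : p u z <;> by_cases hr : r z v <;> simp [hp, hr]

theorem statement12
    (q n k : ℕ) (hq : IsPrimePow q) (hkn : 2 * k < n) (hk : 3 ≤ k)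
    (F V : Type) [Field F] [Fintype F] (hcard : Fintype.card F = q)
    [AddCommGroup V] [Module F V] [FiniteDimensional F V]
    (hdim : Module.finrank F V = n)
    [Fintype (Submodule F V)]
    (x y : GrassVertex F V k)
    (i : ℕ) (hi : (Grass F V k).dist x y = i) (hi1 : 1 < i) (hi2 : i < k) :
    ∀ w ∈ A0set x y, ∀ w' ∈ Apset x y,
      ((q : ℂ) - 1) * gaussC q i * (matF0 y.1 * matFp y.1) w.1 x.1
        = (q : ℂ) ^ (i + 1) * gaussC q (n - k - i) * (matF0 y.1 * matF0 y.1) w'.1 x.1 ∧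
      ((q : ℂ) - 1) * gaussC q i * (matFp y.1 * matFp y.1) w.1 x.1
        = (q : ℂ) ^ (i + 1) * gaussC q (n - k - i) * (matF0 y.1 * matFp y.1) w'.1 x.1 := by
  intro w hw w' hw'
  have hq1 : 1 < q := hcard ▸ Fintype.one_lt_card
  have hk1 : 1 ≤ k := by omega
  have hqC : (q : ℂ) - 1 ≠ 0 := by
    rw [sub_ne_zero]
    exact_mod_cast hq1.ne'
  have hxy := finrank_inf_add_dist hk1 x y
  rw [hi] at hxy
  have hx := x.2
  have hy := y.2
  have dxy := Submodule.finrank_sup_add_finrank_inf_eq x.1 y.1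
  have hwx : TraceAdj y.1 w.1 x.1 ∧ w.1 ⊔ y.1 = x.1 ⊔ y.1 := by
    have h := matF0_apply y.1 w.1 x.1
    unfold matF0 at h
    rw [Matrix.of_apply, if_pos hw.2] at h
    by_contra H
    rw [if_neg H] at h
    exact one_ne_zero h
  have hwx' : TraceAdj y.1 w'.1 x.1 ∧ w'.1 ⊔ y.1 ≠ x.1 ⊔ y.1 := by
    have h := matFp_apply y.1 w'.1 x.1
    unfold matFp at h
    rw [Matrix.of_apply, if_pos hw'.2] at h
    by_contra H
    rw [if_neg H] at h
    exact one_ne_zero h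
  have h0p := matrix_mul_indicator (matF0_apply y.1) (matFp_apply y.1)
  have h00 := matrix_mul_indicator (matF0_apply y.1) (matF0_apply y.1)
  have hpp := matrix_mul_indicator (matFp_apply y.1) (matFp_apply y.1)
  constructor
  · have e1 : (matF0 y.1 * matFp y.1) w.1 x.1 = 0 := by
      rw [h0p, Finset.filter_false_of_mem, Finset.card_empty, Nat.cast_zero]
      rintro z - ⟨⟨-, h1⟩, -, h2⟩
      exact h2 (h1.symm.trans hwx.2)
    have e2 : (matF0 y.1 * matF0 y.1) w'.1 x.1 = 0 := by
      rw [h00, Finset.filter_false_of_mem, Finset.card_empty, Nat.cast_zero]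
      rintro z - ⟨⟨-, h1⟩, -, h2⟩
      exact hwx'.2 (h1.trans h2)
    rw [e1, e2, mul_zero, mul_zero]
  · have dw := hwx.1.finrank_inf
    have dw' := hwx'.1.finrank_inf
    have sw' := hwx'.1.finrank_sup_right
    have ex := hwx.1.1
    have ex' := hwx'.1.1
    have hay : w'.1 ⊓ x.1 ⊓ y.1 = x.1 ⊓ y.1 := by
      rw [inf_inf_distrib_right, hwx'.1.2.1, inf_idem]
    have dhy := Submodule.finrank_sup_add_finrank_inf_eq (w'.1 ⊓ x.1) y.1
    rw [hay] at dhy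
    have c1 := card_coversNotLe_mul (h := w'.1 ⊓ x.1) (b := (w'.1 ⊓ x.1) ⊔ y.1)
      (t := w'.1 ⊔ y.1) le_sup_left (sup_le_sup_right inf_le_left _)
    have c2 := card_coversNotLe_mul (h := w.1 ⊓ x.1) (b := x.1 ⊔ y.1) (t := ⊤)
      (inf_le_right.trans le_sup_left) le_top
    rw [finrank_top, hdim, hcard] at c2
    rw [hcard] at c1
    have v1 : Module.finrank F ↥(w'.1 ⊓ x.1) = k - 1 := by omega
    have v2 : Module.finrank F ↥(w.1 ⊓ x.1) = k - 1 := by omega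
    have v3 : Module.finrank F ↥(x.1 ⊔ y.1) = k + i := by omega
    have v4 : Module.finrank F ↥(w'.1 ⊔ y.1) = k + i := by omega
    have v5 : Module.finrank F ↥((w'.1 ⊓ x.1) ⊔ y.1) = k - 1 + i := by omega
    have hmem : w'.1 ∈ coversNotLe (w'.1 ⊓ x.1) (w'.1 ⊓ x.1 ⊔ y.1) (w'.1 ⊔ y.1) := by
      refine mem_coversNotLe.2 ⟨inf_le_left, by omega, le_sup_left, fun H => ?_⟩
      have := Submodule.finrank_mono (sup_le H le_sup_right)
      omega
    have m1 : (matF0 y.1 * matFp y.1) w'.1 x.1 =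
        ((coversNotLe (w'.1 ⊓ x.1) (w'.1 ⊓ x.1 ⊔ y.1) (w'.1 ⊔ y.1)).card : ℂ) - 1 := by
      rw [h0p, ← Finset.cast_card_erase_of_mem hmem]
      congr 2
      ext z
      rw [Finset.mem_filter, Finset.mem_erase, mem_coversNotLe, matF0_matFp_path_iff hwx',
        and_iff_right (Finset.mem_univ z), and_comm]
    have m2 : (matFp y.1 * matFp y.1) w.1 x.1 =
        ((coversNotLe (w.1 ⊓ x.1) (x.1 ⊔ y.1) ⊤).card : ℂ) := by
      rw [hpp]
      congr 2
      ext z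
      rw [Finset.mem_filter, mem_coversNotLe, matFp_matFp_path_iff hwx,
        and_iff_right (Finset.mem_univ z)]
    rw [m1, m2]
    rw [v2, v3] at c2
    rw [v1, v4, v5] at c1
    obtain ⟨m, rfl⟩ : ∃ m, k = m + 1 := ⟨k - 1, by omega⟩
    obtain ⟨l, hl⟩ : ∃ l, n = m + 1 + i + l := ⟨n - (m + 1) - i, by omega⟩
    have hl' : n - (m + 1) - i = l := by omega
    have hqz (a b : ℕ) (hab : a ≤ b) : ((q ^ b - q ^ a : ℕ) : ℂ) = (q : ℂ) ^ b - (q : ℂ) ^ a := by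
      rw [Nat.cast_sub (Nat.pow_le_pow_right hq1.le hab)]
      push_cast
      rfl
    have hq0 : (q : ℂ) ≠ 0 := by exact_mod_cast (by omega : q ≠ 0)
    have c1C := congrArg (Nat.cast : ℕ → ℂ) c1
    have c2C := congrArg (Nat.cast : ℕ → ℂ) c2
    rw [Nat.cast_mul, hqz _ _ (by omega), hqz _ _ (by omega)] at c1C c2C
    rw [hl']
    subst hl
    simp only [Nat.add_sub_cancel] at c1C c2C ⊢
    generalize (Nat.cast (Finset.card _) : ℂ) = N1 at c1C ⊢
    generalize (Nat.cast (Finset.card _) : ℂ) = N2 at c2C ⊢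
    have hqm : (q : ℂ) ^ m ≠ 0 := pow_ne_zero _ hq0
    have n1 : N1 = (q : ℂ) ^ i :=
      mul_right_cancel₀ (mul_ne_zero hqm hqC) (by linear_combination c1C)
    have n2 : N2 * ((q : ℂ) - 1) = (q : ℂ) ^ (i + 1) * ((q : ℂ) ^ l - 1) :=
      mul_right_cancel₀ hqm (by linear_combination c2C)
    unfold gaussC
    rw [n1]
    field_simp
    linear_combination ((q : ℂ) ^ i - 1) * n2
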